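/- arXiv:0810.1855 — 3 statements merged into one kernel-verified Lean document; each statement's English description precedes it below -/
import Mathlib

section
/- Let d ≥ 1 and let M be a d×d integer matrix with det(1 - M) ≠ 0, where 1 denotes the identity matrix. Then the set of fixed points of the induced endomorphism of the d-torus (ℝ/ℤ)^d (the map sending x to M·x, computed coordinatewise via the ℤ-module structure of ℝ/ℤ) is finite, and its cardinality equals |det(1 - M)|. -/
/-- The endomorphism of the `d`-torus `(ℝ/ℤ)^d` induced by an integer matrix `M`:
`x ↦ M·x mod 1`, computed coordinatewise via the `ℤ`-module structure of `ℝ/ℤ`. -/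
noncomputable def toralMap {d : ℕ} (M : Matrix (Fin d) (Fin d) ℤ)
    (x : Fin d → AddCircle (1 : ℝ)) : Fin d → AddCircle (1 : ℝ) :=
  fun i => ∑ j, M i j • x j

open Matrix

/-- The range of an injective integer matrix acting on `ℤ^d` has index `|det A|`. -/
theorem index_range_mulVec {d : ℕ} (A : Matrix (Fin d) (Fin d) ℤ) (hA : A.det ≠ 0) :
    (LinearMap.range (Matrix.toLin' A)).toAddSubgroup.index = A.det.natAbs := by
  have hinj : Function.Injective (Matrix.toLin' A) :=
    Matrix.mulVec_injective_of_det_ne_zero hA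
  have key := Submodule.natAbs_det_equiv (LinearMap.range (Matrix.toLin' A))
    (LinearEquiv.ofInjective (Matrix.toLin' A) hinj)
  have hcomp : (LinearMap.range (Matrix.toLin' A)).subtype ∘ₗ
      AddMonoidHom.toIntLinearMap
        (LinearEquiv.ofInjective (Matrix.toLin' A) hinj : _ →+ _) = Matrix.toLin' A := rfl
  rw [hcomp, LinearMap.det_toLin'] at key
  rw [key]
  rfl

/-- The projection `ℝ^d → (ℝ/ℤ)^d` intertwines the real action of an integer matrix with
its action on the torus. -/
theorem toralMap_coe {d : ℕ} (A : Matrix (Fin d) (Fin d) ℤ) (y : Fin d → ℝ) :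
    toralMap A (fun i => (y i : AddCircle (1 : ℝ))) =
      fun i => (((A.map (Int.cast : ℤ → ℝ)) *ᵥ y) i : AddCircle (1 : ℝ)) := by
  ext i
  simp only [toralMap, Matrix.mulVec, dotProduct, Matrix.map_apply]
  rw [← QuotientAddGroup.mk'_apply, map_sum]
  refine Finset.sum_congr rfl fun j _ => ?_
  rw [← zsmul_eq_mul, map_zsmul]
  rfl

theorem toralMap_eq_self_iff {d : ℕ} (M : Matrix (Fin d) (Fin d) ℤ)
    (x : Fin d → AddCircle (1 : ℝ)) : toralMap M x = x ↔ toralMap (1 - M) x = 0 := by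
  have hsub : toralMap (1 - M) x = x - toralMap M x := by
    ext i
    simp [toralMap, sub_smul, Finset.sum_sub_distrib, Matrix.one_apply, ite_smul]
  rw [hsub, sub_eq_zero, eq_comm]

/-- A real vector projects to `0` in the torus iff it is integral. -/
theorem coe_torus_eq_zero_iff {d : ℕ} (y : Fin d → ℝ) :
    (fun i => (y i : AddCircle (1 : ℝ))) = 0 ↔ ∃ n : Fin d → ℤ, (fun i => (n i : ℝ)) = y := by
  simp only [funext_iff, Pi.zero_apply, AddCircle.coe_eq_zero_iff, zsmul_eq_mul, mul_one]
  exact Classical.skolem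

/-- The homomorphism `ℤ^d → (ℝ/ℤ)^d`, `n ↦ A⁻¹ n mod 1`. -/
noncomputable def invToTorus {d : ℕ} (A : Matrix (Fin d) (Fin d) ℤ) :
    (Fin d → ℤ) →+ (Fin d → AddCircle (1 : ℝ)) where
  toFun n i := (((A.map (Int.cast : ℤ → ℝ))⁻¹ *ᵥ fun j => (n j : ℝ)) i : ℝ)
  map_zero' := by
    ext i
    have : (fun j => (((0 : Fin d → ℤ) j : ℤ) : ℝ)) = 0 := by ext; simp
    rw [this, Matrix.mulVec_zero]
    simp
  map_add' m n := by
    ext i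
    have : (fun j => (((m + n) j : ℤ) : ℝ)) = (fun j => (m j : ℝ)) + fun j => (n j : ℝ) := by
      ext; simp
    rw [this, Matrix.mulVec_add]
    simp

theorem isUnit_det_map_intCast {d : ℕ} {A : Matrix (Fin d) (Fin d) ℤ} (hA : A.det ≠ 0) :
    IsUnit (A.map (Int.cast : ℤ → ℝ)).det := by
  have : (A.map (Int.cast : ℤ → ℝ)).det = (A.det : ℝ) := (Int.cast_det A).symm
  rw [this, isUnit_iff_ne_zero]
  exact_mod_cast hA

theorem map_intCast_mulVec {d : ℕ} (A : Matrix (Fin d) (Fin d) ℤ) (n : Fin d → ℤ) :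
    (A.map (Int.cast : ℤ → ℝ)) *ᵥ (fun j => (n j : ℝ)) = fun i => ((A *ᵥ n) i : ℝ) := by
  ext i
  simp [Matrix.mulVec, dotProduct]

theorem ker_invToTorus {d : ℕ} {A : Matrix (Fin d) (Fin d) ℤ} (hA : A.det ≠ 0) :
    (invToTorus A).ker = (LinearMap.range (Matrix.toLin' A)).toAddSubgroup := by
  have hu := isUnit_det_map_intCast hA
  ext n
  change (fun i => ((((A.map (Int.cast : ℤ → ℝ))⁻¹ *ᵥ fun j => (n j : ℝ)) i : ℝ) :
    AddCircle (1 : ℝ))) = 0 ↔ ∃ m, Matrix.toLin' A m = n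
  rw [coe_torus_eq_zero_iff]
  refine exists_congr fun m => ⟨fun hm => ?_, fun hm => ?_⟩
  · have h1 := map_intCast_mulVec A m
    rw [hm, Matrix.mulVec_mulVec, Matrix.mul_nonsing_inv _ hu, Matrix.one_mulVec] at h1
    ext i
    have := congrFun h1 i
    rw [Matrix.toLin'_apply]
    exact_mod_cast this.symm
  · rw [← hm, Matrix.toLin'_apply, ← map_intCast_mulVec, Matrix.mulVec_mulVec,
      Matrix.nonsing_inv_mul _ hu, Matrix.one_mulVec]

theorem mem_range_invToTorus_iff {d : ℕ} {A : Matrix (Fin d) (Fin d) ℤ} (hA : A.det ≠ 0)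
    (x : Fin d → AddCircle (1 : ℝ)) : x ∈ (invToTorus A).range ↔ toralMap A x = 0 := by
  have hu := isUnit_det_map_intCast hA
  constructor
  · rintro ⟨n, rfl⟩
    refine (toralMap_coe A _).trans ((coe_torus_eq_zero_iff _).2 ⟨n, ?_⟩)
    rw [Matrix.mulVec_mulVec, Matrix.mul_nonsing_inv _ hu, Matrix.one_mulVec]
  · intro hx
    choose y hy using fun i => QuotientAddGroup.mk_surjective (x i)
    obtain rfl : (fun i => (y i : AddCircle (1 : ℝ))) = x := funext hy
    rw [toralMap_coe, coe_torus_eq_zero_iff] at hx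
    obtain ⟨n, hn⟩ := hx
    refine ⟨n, ?_⟩
    change (fun i => ((((A.map (Int.cast : ℤ → ℝ))⁻¹ *ᵥ fun j => (n j : ℝ)) i : ℝ) :
      AddCircle (1 : ℝ))) = _
    rw [hn, Matrix.mulVec_mulVec, Matrix.nonsing_inv_mul _ hu, Matrix.one_mulVec]

/-- If `det(1 - M) ≠ 0`, the fixed point set of the toral endomorphism induced by `M`
is finite, of cardinality `|det(1 - M)|`. -/
theorem card_fixedPoints_toralMap (d : ℕ) (hd : 1 ≤ d) (M : Matrix (Fin d) (Fin d) ℤ)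
    (h : (1 - M).det ≠ 0) :
    {x : Fin d → AddCircle (1 : ℝ) | toralMap M x = x}.Finite ∧
      Nat.card {x : Fin d → AddCircle (1 : ℝ) | toralMap M x = x} = (1 - M).det.natAbs := by
  have hset : {x : Fin d → AddCircle (1 : ℝ) | toralMap M x = x} =
      ((invToTorus (1 - M)).range : Set (Fin d → AddCircle (1 : ℝ))) := by
    ext x
    exact (toralMap_eq_self_iff M x).trans (mem_range_invToTorus_iff h x).symm
  have hcard : Nat.card {x : Fin d → AddCircle (1 : ℝ) | toralMap M x = x} =
      (1 - M).det.natAbs := by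
    rw [hset, ← index_range_mulVec _ h, ← ker_invToTorus h, AddSubgroup.index_ker]
    rfl
  exact ⟨Nat.finite_of_card_ne_zero (hcard ▸ Int.natAbs_ne_zero.2 h), hcard⟩
end

section
/- Let d ≥ 1 and let M be a d×d integer matrix with D := det(M) ≠ 0. For 0 ≤ k ≤ d define the polynomial p_k(z) := det(1 - z·Λ^k(M)) ∈ ℚ[z], and set β_0 := 1 and β_j := D^{C(d-1, j-1)} for 1 ≤ j ≤ d. Then for every k with 0 ≤ k ≤ d and every nonzero z ∈ ℚ, one has β_{d-k} · (-z)^{C(d,k)} · p_k(1/(D·z)) = p_{d-k}(z). -/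
/-- The `k`-th exterior power (compound) matrix of `A`: the matrix of the induced
endomorphism `Λ^k(A)` of the `k`-th exterior power in the standard basis, i.e. the
`C(d,k) × C(d,k)` matrix of all `k × k` minors of `A`. -/
def extMatrix {d : ℕ} {R : Type*} [CommRing R] (A : Matrix (Fin d) (Fin d) R) (k : ℕ) :
    Matrix {s : Finset (Fin d) // s.card = k} {s : Finset (Fin d) // s.card = k} R :=
  fun S T => (Matrix.of fun i j : Fin k =>
    A (S.1.orderIsoOfFin S.2 i) (T.1.orderIsoOfFin T.2 j)).det

open Module in
/-- Over an algebraically closed field, every endomorphism has a lower triangular matrix in a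
suitable basis. -/
theorem Module.End.exists_basis_isLowerTriangular {K : Type*} [Field K] [IsAlgClosed K] (n : ℕ) :
    ∀ {V : Type*} [AddCommGroup V] [Module K V] [FiniteDimensional K V], finrank K V = n →
      ∀ f : Module.End K V,
        ∃ b : Basis (Fin n) K V, (LinearMap.toMatrix b b f).IsLowerTriangular := by
  induction n with
  | zero =>
    intro V _ _ _ hn f
    exact ⟨finBasisOfFinrankEq K V hn, fun i => i.elim0⟩
  | succ n ih =>
    intro V _ _ _ hn f
    have : Nontrivial V := nontrivial_of_finrank_pos (R := K) (by omega)
    obtain ⟨μ, hμ⟩ := Module.End.exists_eigenvalue f.dualMap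
    obtain ⟨φ, hφ⟩ := hμ.exists_hasEigenvector
    have hφf (x : V) : φ (f x) = μ * φ x := DFunLike.congr_fun hφ.apply_eq_smul x
    obtain ⟨y, hy⟩ : ∃ y, φ y ≠ 0 := by
      by_contra! h
      exact hφ.2 (LinearMap.ext h)
    have hker : finrank K (LinearMap.ker φ) = n := by
      have := Module.Dual.finrank_ker_add_one_of_ne_zero hφ.2
      omega
    have hinv (x : V) (hx : x ∈ LinearMap.ker φ) : f x ∈ LinearMap.ker φ := by
      rw [LinearMap.mem_ker] at hx ⊢
      rw [hφf, hx, mul_zero]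
    obtain ⟨b, hb⟩ := ih hker (f.restrict hinv)
    let B : Basis (Fin (n + 1)) K V := Basis.mkFinCons y b
      (fun c x hx h => by
        have := congrArg φ h
        rw [LinearMap.mem_ker] at hx
        simpa [hx, hy] using this)
      (fun z => ⟨-(φ z / φ y), by simp [hy]⟩)
    have hB : (B : Fin (n + 1) → V) = Fin.cons y ((↑) ∘ b) := Basis.coe_mkFinCons _ _ _ _
    have hrepr (x : LinearMap.ker φ) : B.repr x = Finsupp.cons 0 (b.repr x) := by
      apply B.repr.symm.injective
      rw [LinearEquiv.symm_apply_apply, Basis.repr_symm_apply, Finsupp.linearCombination_apply,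
        Finsupp.sum_fintype _ _ (by simp), Fin.sum_univ_succ]
      have hx := congrArg Subtype.val (b.sum_repr x)
      rw [Submodule.coe_sum] at hx
      simpa [hB] using hx.symm
    refine ⟨B, fun i j hij => ?_⟩
    replace hij : i < j := hij
    obtain ⟨j, rfl⟩ := Fin.exists_succ_eq.2 (Fin.ne_zero_of_lt hij)
    have hj : f (B j.succ) = (f.restrict hinv (b j) : V) := by simp [hB]
    rw [LinearMap.toMatrix_apply, hj, hrepr]
    cases i using Fin.cases with
    | zero => simp
    | succ i =>
      rw [Finsupp.cons_succ, ← LinearMap.toMatrix_apply b b]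
      exact hb (Fin.succ_lt_succ_iff.1 hij)

/-- A matrix whose nonzero off-diagonal entries strictly decrease a rank function has determinant
the product of its diagonal. -/
theorem Matrix.det_eq_prod_diag_of_rank {ι R : Type*} [Fintype ι] [DecidableEq ι] [CommRing R]
    (A : Matrix ι ι R) (r : ι → ℕ) (h : ∀ i j, i ≠ j → r i ≤ r j → A i j = 0) :
    A.det = ∏ i, A i i := by
  rw [Matrix.det_apply, Finset.sum_eq_single 1]
  · simp
  · intro σ _ hσ
    obtain ⟨i, hi, hri⟩ : ∃ i, σ i ≠ i ∧ r (σ i) ≤ r i := by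
      by_contra! hlt
      obtain ⟨i, hi⟩ : ∃ i, σ i ≠ i := by
        by_contra! h1
        exact hσ (Equiv.ext h1)
      refine (Equiv.sum_comp σ r).not_gt
        (Finset.sum_lt_sum (fun j _ => ?_) ⟨i, Finset.mem_univ i, hlt i hi⟩)
      by_cases hj : σ j = j
      · rw [hj]
      · exact (hlt j hj).le
    exact smul_eq_zero_of_right _ (Finset.prod_eq_zero (Finset.mem_univ i) (h _ _ hi hri))
  · simp

theorem extMatrix_map {d : ℕ} {R S : Type*} [CommRing R] [CommRing S] (f : R →+* S)
    (A : Matrix (Fin d) (Fin d) R) (k : ℕ) : extMatrix (A.map f) k = (extMatrix A k).map f := by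
  ext s t
  simp only [extMatrix, Matrix.map_apply, RingHom.map_det]
  rfl

theorem extMatrix_apply_self_of_isLowerTriangular {d : ℕ} {R : Type*} [CommRing R]
    {A : Matrix (Fin d) (Fin d) R} (hA : A.IsLowerTriangular) {k : ℕ}
    (s : {s : Finset (Fin d) // s.card = k}) : extMatrix A k s s = ∏ i ∈ s.1, A i i := by
  have hlow : (Matrix.of fun i j : Fin k => A (s.1.orderIsoOfFin s.2 i)
      (s.1.orderIsoOfFin s.2 j)).IsLowerTriangular :=
    fun i j hij => hA (i := s.1.orderIsoOfFin s.2 i) (j := s.1.orderIsoOfFin s.2 j)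
      ((s.1.orderIsoOfFin s.2).strictMono hij)
  refine (Matrix.det_of_isLowerTriangular _ hlow).trans ?_
  simp only [Matrix.of_apply]
  refine (Equiv.prod_comp (s.1.orderIsoOfFin s.2).toEquiv (fun i : s.1 => A i i)).trans ?_
  exact Finset.prod_coe_sort s.1 (fun i => A i i)

theorem extMatrix_apply_eq_zero_of_isLowerTriangular {d : ℕ} {R : Type*} [CommRing R]
    {A : Matrix (Fin d) (Fin d) R} (hA : A.IsLowerTriangular) {k : ℕ}
    {s t : {s : Finset (Fin d) // s.card = k}} (hst : s ≠ t)
    (hle : ∑ i ∈ s.1, (i : ℕ) ≤ ∑ i ∈ t.1, (i : ℕ)) : extMatrix A k s t = 0 := by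
  rw [extMatrix, Matrix.det_apply]
  refine Finset.sum_eq_zero fun σ _ => ?_
  have sum_eq (u : {s : Finset (Fin d) // s.card = k}) :
      ∑ i ∈ u.1, (i : ℕ) = ∑ i, ((u.1.orderIsoOfFin u.2 i : Fin d) : ℕ) := by
    rw [← Finset.sum_coe_sort u.1 (fun i => (i : ℕ)),
      ← Equiv.sum_comp (u.1.orderIsoOfFin u.2).toEquiv]
    rfl
  obtain ⟨i, hi⟩ : ∃ i, (s.1.orderIsoOfFin s.2 (σ i) : Fin d) < t.1.orderIsoOfFin t.2 i := by
    by_contra! h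
    rw [sum_eq, sum_eq, ← Equiv.sum_comp σ] at hle
    have heq := (Finset.sum_eq_sum_iff_of_le fun i _ => Fin.val_le_of_le (h i)).1
      (le_antisymm (Finset.sum_le_sum fun i _ => Fin.val_le_of_le (h i)) hle)
    refine hst (Subtype.ext (Finset.eq_of_subset_of_card_le (fun x hx => ?_) ?_).symm)
    · obtain ⟨i, hi⟩ := (t.1.orderIsoOfFin t.2).surjective ⟨x, hx⟩
      have := Fin.ext (heq i (Finset.mem_univ i))
      rw [hi] at this
      change x = _ at this
      exact this ▸ Subtype.coe_prop _
    · rw [s.2, t.2]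
  exact smul_eq_zero_of_right _ (Finset.prod_eq_zero (Finset.mem_univ i) (hA hi))

theorem det_one_sub_smul_extMatrix_of_isLowerTriangular {d : ℕ} {R : Type*} [CommRing R]
    {A : Matrix (Fin d) (Fin d) R} (hA : A.IsLowerTriangular) (k : ℕ) (z : R) :
    (1 - z • extMatrix A k).det =
      ∏ s : {s : Finset (Fin d) // s.card = k}, (1 - z * ∏ i ∈ s.1, A i i) := by
  rw [Matrix.det_eq_prod_diag_of_rank _ (fun s => ∑ i ∈ s.1, (Fin.val i))]
  · simp [extMatrix_apply_self_of_isLowerTriangular hA]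
  · intro s t hst hle
    simp [hst, extMatrix_apply_eq_zero_of_isLowerTriangular hA hst hle]

open Module in
/-- `Module.Basis.exteriorPower`, indexed as the rows and columns of `extMatrix`. -/
noncomputable def extBasis {d : ℕ} {R V : Type*} [CommRing R] [AddCommGroup V] [Module R V]
    (b : Basis (Fin d) R V) (k : ℕ) : Basis {s : Finset (Fin d) // s.card = k} R (⋀[R]^k V) :=
  b.exteriorPower k

open Module in
theorem toMatrix_exteriorPower_map {d : ℕ} {R V : Type*} [CommRing R] [AddCommGroup V] [Module R V]
    (b : Basis (Fin d) R V) (f : V →ₗ[R] V) (k : ℕ) :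
    LinearMap.toMatrix (extBasis b k) (extBasis b k) (exteriorPower.map k f) =
      extMatrix (LinearMap.toMatrix b b f) k := by
  have hrepr (s t : Set.powersetCard (Fin d) k) :
      (b.exteriorPower k).repr (exteriorPower.map k f (b.exteriorPower k t)) s =
        (Matrix.of fun i j : Fin k => LinearMap.toMatrix b b f
          (s.1.orderIsoOfFin s.2 i) (t.1.orderIsoOfFin t.2 j)).det := by
    rw [exteriorPower.basis_repr_apply, exteriorPower.basis_apply,
      exteriorPower.map_apply_ιMulti_family, exteriorPower.ιMulti_family,
      exteriorPower.ιMultiDual_apply_ιMulti, ← Matrix.det_transpose]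
    congr 1
    ext i j
    simp only [Matrix.of_apply, Matrix.transpose_apply, Function.comp_apply, Basis.coord_apply,
      LinearMap.toMatrix_apply]
    rfl
  ext s t
  rw [LinearMap.toMatrix_apply]
  exact hrepr s t

open Module in
theorem det_one_sub_smul_extMatrix_toMatrix {d : ℕ} {R V : Type*} [CommRing R] [AddCommGroup V]
    [Module R V] (b : Basis (Fin d) R V) (f : V →ₗ[R] V) (k : ℕ) (z : R) :
    (1 - z • extMatrix (LinearMap.toMatrix b b f) k).det =
      LinearMap.det (LinearMap.id - z • exteriorPower.map k f) := by
  rw [← toMatrix_exteriorPower_map, ← LinearMap.det_toMatrix (extBasis b k),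
    ← LinearMap.toMatrix_id (extBasis b k), ← map_smul]
  exact congrArg Matrix.det (map_sub (LinearMap.toMatrix (extBasis b k) (extBasis b k)) _ _).symm

open Module in
/-- Over an algebraically closed field, the polynomials `det (1 - z Λ^k A)` factor simultaneously
through the eigenvalues of `A`. -/
theorem exists_eigenvalues_det_one_sub_smul_extMatrix {K : Type*} [Field K] [IsAlgClosed K] {d : ℕ}
    (A : Matrix (Fin d) (Fin d) K) :
    ∃ l : Fin d → K, A.det = ∏ i, l i ∧ ∀ k z, (1 - z • extMatrix A k).det =
      ∏ s : {s : Finset (Fin d) // s.card = k}, (1 - z * ∏ i ∈ s.1, l i) := by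
  obtain ⟨b, hb⟩ := Module.End.exists_basis_isLowerTriangular d (finrank_fin_fun K)
    (Matrix.toLin (Pi.basisFun K (Fin d)) (Pi.basisFun K (Fin d)) A)
  refine ⟨fun i => LinearMap.toMatrix b b
    (Matrix.toLin (Pi.basisFun K (Fin d)) (Pi.basisFun K (Fin d)) A) i i, ?_, fun k z => ?_⟩
  · rw [← Matrix.det_of_isLowerTriangular _ hb, LinearMap.det_toMatrix, LinearMap.det_toLin]
  · rw [← det_one_sub_smul_extMatrix_of_isLowerTriangular hb,
      det_one_sub_smul_extMatrix_toMatrix,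
      ← det_one_sub_smul_extMatrix_toMatrix (Pi.basisFun K (Fin d)), LinearMap.toMatrix_toLin]

theorem prod_powersetCard_prod {α R : Type*} [Fintype α] [DecidableEq α] [CommMonoid R]
    (l : α → R) (m : ℕ) :
    ∏ s : {s : Finset α // s.card = m + 1}, ∏ i ∈ s.1, l i =
      (∏ i, l i) ^ (Fintype.card α - 1).choose m := by
  rw [← Finset.prod_subtype (Finset.univ.powersetCard (m + 1)) (by simp) (fun s => ∏ i ∈ s, l i),
    Finset.prod_comm' (t' := Finset.univ)
      (s' := fun i => {s ∈ Finset.univ.powersetCard (m + 1) | {i} ⊆ s}) (by simp),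
    ← Finset.prod_pow]
  refine Finset.prod_congr rfl fun i _ => ?_
  rw [Finset.prod_const, Finset.card_filter_powersetCard_subset] <;> simp

/-- The functional equation for the products `∏ (1 - z l_S)` over `k`-subsets `S`, where `l_S` is
the product of the `l i` with `i ∈ S`. -/
theorem prod_powersetCard_one_sub_functional_equation {K : Type*} [Field K] {d : ℕ}
    (l : Fin d → K) (hl : ∏ i, l i ≠ 0) {k : ℕ} (hk : k ≤ d) {z : K} (hz : z ≠ 0) :
    (∏ s : {s : Finset (Fin d) // s.card = d - k}, ∏ i ∈ s.1, l i) * (-z) ^ d.choose k *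
      ∏ s : {s : Finset (Fin d) // s.card = k}, (1 - 1 / ((∏ i, l i) * z) * ∏ i ∈ s.1, l i) =
    ∏ s : {s : Finset (Fin d) // s.card = d - k}, (1 - z * ∏ i ∈ s.1, l i) := by
  let e : {s : Finset (Fin d) // s.card = k} ≃ {s : Finset (Fin d) // s.card = d - k} :=
    Set.powersetCard.compl (by simp [hk])
  have he (s) : (e s).1 = s.1ᶜ := rfl
  have hcard : d.choose k = (Finset.univ : Finset {s : Finset (Fin d) // s.card = k}).card := by
    simp
  rw [← Equiv.prod_comp e, ← Equiv.prod_comp e, hcard, ← Finset.prod_const,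
    ← Finset.prod_mul_distrib, ← Finset.prod_mul_distrib]
  refine Finset.prod_congr rfl fun s _ => ?_
  rw [he]
  have hs := Finset.prod_mul_prod_compl s.1 l
  rw [← hs] at hl ⊢
  have := left_ne_zero_of_mul hl
  have := right_ne_zero_of_mul hl
  field_simp
  ring

/-- Functional equation for the polynomials `p_k(z) = det(1 - z·Λ^k(M))`:
for `D = det M ≠ 0`, `β_{d-k} · (-z)^{C(d,k)} · p_k(1/(D·z)) = p_{d-k}(z)` for all
nonzero `z ∈ ℚ`, where `β_0 = 1` and `β_j = D^{C(d-1,j-1)}` for `1 ≤ j ≤ d`. -/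
theorem extMatrix_det_functional_equation (d : ℕ) (hd : 1 ≤ d)
    (M : Matrix (Fin d) (Fin d) ℤ) (hD : M.det ≠ 0)
    (p : ℕ → ℚ → ℚ)
    (hp : ∀ k z, p k z = Matrix.det (1 - z • extMatrix (M.map ((↑) : ℤ → ℚ)) k))
    (β : ℕ → ℚ)
    (hβ : ∀ j, β j = if j = 0 then 1 else (M.det : ℚ) ^ ((d - 1).choose (j - 1)))
    (k : ℕ) (hk : k ≤ d) (z : ℚ) (hz : z ≠ 0) :
    β (d - k) * (-z) ^ d.choose k * p k (1 / ((M.det : ℚ) * z)) = p (d - k) z := by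
  obtain ⟨l, hdet, hl⟩ := exists_eigenvalues_det_one_sub_smul_extMatrix
    ((M.map ((↑) : ℤ → ℚ)).map (Rat.castHom ℂ))
  have hdet : (M.det : ℂ) = ∏ i, l i := by
    rw [← hdet, ← RingHom.mapMatrix_apply, ← RingHom.map_det, ← Int.cast_det]
    simp
  have hp' (k : ℕ) (z : ℚ) : (p k z : ℂ) =
      ∏ s : {s : Finset (Fin d) // s.card = k}, (1 - (z : ℂ) * ∏ i ∈ s.1, l i) := by
    rw [← hl, hp, extMatrix_map, ← Rat.coe_castHom, RingHom.map_det]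
    congr 1
    ext i j
    by_cases hij : i = j <;> simp [hij]
  have hβ' (j : ℕ) : (β j : ℂ) =
      ∏ s : {s : Finset (Fin d) // s.card = j}, ∏ i ∈ s.1, l i := by
    cases j with
    | zero =>
      rw [hβ, Finset.prod_eq_one fun s _ => ?_]
      · simp
      · rw [Finset.card_eq_zero.1 s.2, Finset.prod_empty]
    | succ m =>
      rw [prod_powersetCard_prod, ← hdet, hβ]
      simp
  have hD' : ∏ i, l i ≠ 0 := by
    rw [← hdet]
    exact_mod_cast hD
  have key := prod_powersetCard_one_sub_functional_equation l hD' hk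
    (Rat.cast_ne_zero (α := ℂ).2 hz)
  have hpk := hp' k (1 / ((M.det : ℚ) * z))
  rw [Rat.cast_div, Rat.cast_one, Rat.cast_mul, Rat.cast_intCast, hdet] at hpk
  rw [← hpk, ← hβ', ← hp'] at key
  exact_mod_cast key
end

section
/- Let d ≥ 1 and let M be a d×d integer matrix with det(1 + M) ≠ 0 and det(1 - M) ≠ 0. Then for every m ≥ 1, |det(1 - M^m)| = sgn(det(1 + M))^{m+1} · sgn(det(1 - M)) · det(1 - M^m), where sgn denotes the sign (±1) of a nonzero integer. -/
open ComplexConjugate in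
/-- The non-real factors of a conjugation-equivariant product pair up to a nonnegative real. -/
theorem exists_nonneg_prod_eq_mul_prod_filter_im_eq_zero (S : Finset ℂ) (f : ℂ → ℂ)
    (hS : ∀ z ∈ S, conj z ∈ S) (hf : ∀ z, f (conj z) = conj (f z)) :
    ∃ r : ℝ, 0 ≤ r ∧ ∏ z ∈ S, f z = r * ∏ z ∈ S with z.im = 0, f z := by
  refine ⟨Complex.normSq (∏ z ∈ S with 0 < z.im, f z), Complex.normSq_nonneg _, ?_⟩
  have hneg : ∏ z ∈ S with z.im < 0, f z = conj (∏ z ∈ S with 0 < z.im, f z) := by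
    rw [map_prod]
    refine Finset.prod_bij' (fun z _ => conj z) (fun z _ => conj z) ?_ ?_ ?_ ?_ ?_
    · intro z hz
      simp only [Finset.mem_filter] at hz ⊢
      exact ⟨hS z hz.1, by simpa using hz.2⟩
    · intro z hz
      simp only [Finset.mem_filter] at hz ⊢
      exact ⟨hS z hz.1, by simpa using hz.2⟩
    · simp
    · simp
    · intro z _
      simp [hf]
  have hne : ∏ z ∈ S with z.im ≠ 0, f z =
      (∏ z ∈ S with 0 < z.im, f z) * ∏ z ∈ S with z.im < 0, f z := by
    rw [← Finset.prod_filter_mul_prod_filter_not (S.filter fun z => z.im ≠ 0)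
      (fun z => 0 < z.im), Finset.filter_filter, Finset.filter_filter]
    congr 2 <;> ext z <;> simp only [Finset.mem_filter] <;> grind
  rw [← Finset.prod_filter_mul_prod_filter_not S (fun z => z.im = 0), hne, hneg,
    Complex.mul_conj, mul_comm]

theorem Complex.filter_im_eq_zero_nthRootsFinset_one {m : ℕ} (hm : 0 < m) :
    {z ∈ Polynomial.nthRootsFinset m (1 : ℂ) | z.im = 0} = if Even m then {1, -1} else {1} := by
  ext z
  have hreal : z.im = 0 → z ^ m = 1 → z = 1 ∨ z = -1 := by
    intro hz h
    lift z to ℝ using hz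
    norm_cast at h ⊢
    simpa [hm.ne'] using (pow_eq_one_iff_cases.1 h).imp_right (Or.imp_right And.left)
  split_ifs with hev
  · simp only [Finset.mem_filter, Polynomial.mem_nthRootsFinset hm, Finset.mem_insert,
      Finset.mem_singleton]
    refine ⟨fun h => hreal h.2 h.1, ?_⟩
    rintro (rfl | rfl) <;> simp [hev]
  · simp only [Finset.mem_filter, Polynomial.mem_nthRootsFinset hm, Finset.mem_singleton]
    refine ⟨fun h => (hreal h.2 h.1).resolve_right ?_, ?_⟩
    · rintro rfl
      have := h.1
      rw [(Nat.not_even_iff_odd.1 hev).neg_one_pow] at this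
      norm_num at this
    · rintro rfl
      simp

theorem Matrix.det_pow_sub_one_eq_prod {n : Type*} [Fintype n] [DecidableEq n]
    (A : Matrix n n ℂ) {m : ℕ} (hm : 0 < m) :
    (A ^ m - 1).det =
      ∏ z ∈ Polynomial.nthRootsFinset m (1 : ℂ), (A - algebraMap ℂ _ z).det := by
  have h := congrArg (fun p => (Polynomial.aeval A p).det)
    (Polynomial.X_pow_sub_one_eq_prod hm (Complex.isPrimitiveRoot_exp m hm.ne'))
  simp only [map_sub, map_pow, Polynomial.aeval_X, map_one] at h
  rw [h, ← Finset.prod_map_toList, map_list_prod, ← Matrix.coe_detMonoidHom, map_list_prod,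
    List.map_map, List.map_map, Finset.prod_map_toList]
  simp

/-- Up to a nonnegative factor, `det (M ^ m - 1)` is given by the real `m`-th roots of unity. -/
theorem Matrix.exists_nonneg_det_pow_sub_one_eq {n : Type*} [Fintype n] [DecidableEq n]
    (M : Matrix n n ℤ) {m : ℕ} (hm : 0 < m) :
    ∃ r : ℝ, 0 ≤ r ∧ ((M ^ m - 1).det : ℝ) =
      r * ((M - 1).det * if Even m then (M + 1).det else 1 : ℤ) := by
  set A : Matrix n n ℂ := M.map (Int.castRingHom ℂ) with hA
  have hcast (B : Matrix n n ℤ) : ((B.det : ℤ) : ℂ) = ((Int.castRingHom ℂ).mapMatrix B).det :=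
    (Int.castRingHom ℂ).map_det B
  have hAM : (Int.castRingHom ℂ).mapMatrix M = A := rfl
  obtain ⟨r, hr, h⟩ := exists_nonneg_prod_eq_mul_prod_filter_im_eq_zero
    (Polynomial.nthRootsFinset m (1 : ℂ)) (fun z => (A - algebraMap ℂ _ z).det)
    (fun z hz => by
      rw [Polynomial.mem_nthRootsFinset hm] at hz ⊢
      rw [← map_pow, hz, map_one])
    (fun z => by
      rw [RingHom.map_det]
      congr 1
      ext i j
      by_cases hij : i = j <;> simp [hA, Matrix.algebraMap_matrix_apply, hij])
  refine ⟨r, hr, ?_⟩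
  rw [← A.det_pow_sub_one_eq_prod hm, Complex.filter_im_eq_zero_nthRootsFinset_one hm] at h
  apply Complex.ofReal_injective
  rw [Complex.ofReal_mul, Complex.ofReal_intCast, Complex.ofReal_intCast, Int.cast_mul, hcast,
    map_sub, map_pow, map_one, hAM, h]
  split_ifs
  · rw [Finset.prod_pair (by norm_num), hcast, hcast, map_sub, map_add, map_one, hAM]
    simp
  · rw [Finset.prod_singleton, hcast, map_sub, map_one, hAM]
    simp

/-- If `det(1 + M) ≠ 0` and `det(1 - M) ≠ 0`, then for all `m ≥ 1`,
`|det(1 - M^m)| = sgn(det(1 + M))^{m+1} · sgn(det(1 - M)) · det(1 - M^m)`. -/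
theorem abs_det_one_sub_pow_eq_sign (d : ℕ) (hd : 1 ≤ d) (M : Matrix (Fin d) (Fin d) ℤ)
    (h₁ : (1 + M).det ≠ 0) (h₂ : (1 - M).det ≠ 0) (m : ℕ) (hm : 1 ≤ m) :
    |(1 - M ^ m).det| =
      Int.sign ((1 + M).det) ^ (m + 1) * Int.sign ((1 - M).det) * (1 - M ^ m).det := by
  obtain ⟨r, hr, h⟩ := M.exists_nonneg_det_pow_sub_one_eq hm
  have hswap (B : Matrix (Fin d) (Fin d) ℤ) : (B - 1).det = (-1) ^ d * (1 - B).det := by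
    rw [← neg_sub 1 B, Matrix.det_neg, Fintype.card_fin]
  rw [hswap, hswap, add_comm M 1] at h
  generalize (1 + M).det = a at *
  generalize (1 - M).det = b at *
  generalize (1 - M ^ m).det = c at *
  have hc : (c : ℝ) = r * (b * if Even m then a else 1 : ℤ) := by
    push_cast at h ⊢
    refine mul_left_cancel₀ (pow_ne_zero d (neg_ne_zero.2 (one_ne_zero (α := ℝ)))) ?_
    rw [h]
    ring
  have hsign : 0 ≤ c * (b * if Even m then a else 1) := by
    have : (0 : ℝ) ≤ c * (b * if Even m then a else 1 : ℤ) := by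
      rw [hc, mul_assoc]
      exact mul_nonneg hr (mul_self_nonneg _)
    exact_mod_cast this
  have ha : a.sign ^ 2 = 1 := by
    rcases h₁.lt_or_gt with ha | ha
    · simp [Int.sign_eq_neg_one_of_neg ha]
    · simp [Int.sign_eq_one_of_pos ha]
  have hpow : a.sign ^ (m + 1) * b.sign = (b * if Even m then a else 1).sign := by
    split_ifs with hev
    · obtain ⟨k, rfl⟩ := hev
      rw [Int.sign_mul, ← two_mul, pow_succ, pow_mul, ha, one_pow, one_mul, mul_comm]
    · obtain ⟨k, rfl⟩ := Nat.not_even_iff_odd.1 hev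
      rw [show 2 * k + 1 + 1 = 2 * (k + 1) by ring, pow_mul, ha, one_pow, one_mul, mul_one]
  have he : (b * if Even m then a else 1) ≠ 0 := mul_ne_zero h₂ (by split_ifs <;> simp [h₁])
  rw [hpow]
  generalize (b * if Even m then a else 1) = e at *
  rcases he.lt_or_gt with he | he
  · rw [Int.sign_eq_neg_one_of_neg he, abs_of_nonpos (nonpos_of_mul_nonneg_left hsign he)]
    ring
  · rw [Int.sign_eq_one_of_pos he, abs_of_nonneg (nonneg_of_mul_nonneg_left hsign he), one_mul]
end
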